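/- (In-expectation bound, Rényi version.) Let f: 𝒮×𝒲 → (0,∞) be measurable and α > 1. Then log E_{(S,W)∼P_{S,W}}[f(S,W)] ≤ inf over Markov kernels q_{W|S} from 𝒮 to 𝒲 and over λ ≥ α/(α−1) of { (1/λ) D_α( P_{S,W} ‖ P_S ⊗ q_{W|S} ) + (1/λ) log E_{P_S ⊗ q_{W|S}}[ f(S,W)^λ ] }. -/

import Mathlib

open MeasureTheory ProbabilityTheory Filter
open scoped ENNReal Classical

/-- Kullback–Leibler divergence `D_KL(Q ‖ P)`, with value `⊤` unless `Q ≪ P` and the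
log-likelihood ratio is integrable. -/
noncomputable def klDiv {Ω : Type*} [MeasurableSpace Ω] (Q P : Measure Ω) : EReal :=
  if Q ≪ P ∧ Integrable (fun x => Real.log (Q.rnDeriv P x).toReal) Q
  then ((∫ x, Real.log (Q.rnDeriv P x).toReal ∂Q : ℝ) : EReal)
  else ⊤

/-- Rényi divergence `D_α(Q ‖ P) = (α−1)⁻¹ log E_Q[(dQ/dP)^{α−1}]`, with value `⊤` unless
`Q ≪ P` and the integrand is integrable. -/
noncomputable def renyiDiv {Ω : Type*} [MeasurableSpace Ω] (a : ℝ) (Q P : Measure Ω) : EReal :=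
  if Q ≪ P ∧ Integrable (fun x => ((Q.rnDeriv P x).toReal) ^ (a - 1)) Q
  then (((a - 1)⁻¹ * Real.log (∫ x, ((Q.rnDeriv P x).toReal) ^ (a - 1) ∂Q) : ℝ) : EReal)
  else ⊤


/-- Jensen's inequality followed by Hölder's inequality, after a change of measure. -/
lemma renyi_holder {Ω : Type*} [MeasurableSpace Ω] (Q P : Measure Ω)
    [IsProbabilityMeasure Q] [IsProbabilityMeasure P] (hQP : Q ≪ P)
    (f : Ω → ℝ≥0∞) (hf : Measurable f) (a lam : ℝ) (ha : 1 < a) (hl : a / (a - 1) ≤ lam) :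
    ∫⁻ x, f x ∂Q ≤ ((∫⁻ x, (Q.rnDeriv P x) ^ (a - 1) ∂Q) ^ ((a - 1)⁻¹)) ^ (lam⁻¹)
      * (∫⁻ x, f x ^ lam ∂P) ^ (lam⁻¹) := by
  have ha1 : 0 < a - 1 := by linarith
  have ha0 : 0 < a := by linarith
  set b := a / (a - 1) with hb
  have hb0 : 0 < b := by positivity
  have hl0 : 0 < lam := lt_of_lt_of_le hb0 hl
  have hconj : a.HolderConjugate b := Real.HolderConjugate.conjExponent ha
  have hg : Measurable (Q.rnDeriv P) := Measure.measurable_rnDeriv Q P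
  have hbl : 1 ≤ lam / b := by rwa [le_div_iff₀ hb0, one_mul]
  have jensen : ∫⁻ x, f x ∂Q ≤ (∫⁻ x, f x ^ (lam / b) ∂Q) ^ (b / lam) := by
    have h := eLpNorm'_le_eLpNorm'_of_exponent_le (f := f) one_pos hbl Q
      hf.aestronglyMeasurable
    simpa [eLpNorm'] using h
  have hG : ∫⁻ x, (Q.rnDeriv P x) ^ (a - 1) ∂Q = ∫⁻ x, (Q.rnDeriv P x) ^ a ∂P := by
    rw [← lintegral_rnDeriv_mul hQP (hg.pow_const _).aemeasurable]
    refine lintegral_congr fun x => ?_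
    conv_lhs => rw [← ENNReal.rpow_one (Q.rnDeriv P x), ← ENNReal.rpow_mul, one_mul]
    rw [← ENNReal.rpow_add_of_nonneg _ _ zero_le_one ha1.le]
    congr 1
    ring
  have holder : ∫⁻ x, f x ^ (lam / b) ∂Q ≤
      (∫⁻ x, (Q.rnDeriv P x) ^ a ∂P) ^ (1 / a) * (∫⁻ x, f x ^ lam ∂P) ^ (1 / b) := by
    have h := ENNReal.lintegral_mul_le_Lp_mul_Lq P hconj hg.aemeasurable
      (hf.pow_const (lam / b)).aemeasurable
    simp only [Pi.mul_apply] at h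
    rw [lintegral_rnDeriv_mul hQP (hf.pow_const _).aemeasurable] at h
    simpa only [← ENNReal.rpow_mul, div_mul_cancel₀ _ hb0.ne'] using h
  refine jensen.trans ((ENNReal.rpow_le_rpow holder (by positivity)).trans (le_of_eq ?_))
  rw [hG, ENNReal.mul_rpow_of_nonneg _ _ (by positivity), ← ENNReal.rpow_mul,
    ← ENNReal.rpow_mul, ← ENNReal.rpow_mul]
  congr 2
  · rw [hb]; field_simp
  · field_simp

lemma renyi_bound {Ω : Type*} [MeasurableSpace Ω] (Q P : Measure Ω)
    [IsProbabilityMeasure Q] [IsProbabilityMeasure P]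
    (f : Ω → ℝ) (hf : Measurable f) (hfpos : ∀ p, 0 < f p)
    (a lam : ℝ) (ha : 1 < a) (hl : a / (a - 1) ≤ lam) :
    ((Real.log (∫ p, f p ∂Q) : ℝ) : EReal) ≤
      ((lam⁻¹ : ℝ) : EReal) * renyiDiv a Q P
        + ((lam⁻¹ : ℝ) : EReal) * ENNReal.log (∫⁻ r, ENNReal.ofReal (f r ^ lam) ∂P) := by
  have ha1 : 0 < a - 1 := by linarith
  have hl0 : 0 < lam := lt_of_lt_of_le (by positivity) hl
  have hpow : ∀ r, ENNReal.ofReal (f r ^ lam) = ENNReal.ofReal (f r) ^ lam := fun r =>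
    (ENNReal.ofReal_rpow_of_pos (hfpos r)).symm
  simp_rw [hpow]
  have hne : ∀ (ρ : Measure Ω) [IsProbabilityMeasure ρ] (h : Ω → ℝ≥0∞), Measurable h →
      (∀ x, h x ≠ 0) → (∫⁻ x, h x ∂ρ) ≠ 0 := by
    intro ρ _ h hm hx h0
    rw [lintegral_eq_zero_iff hm] at h0
    obtain ⟨x, hx'⟩ := h0.exists
    exact hx x hx'
  have hF : Measurable fun x => ENNReal.ofReal (f x) := hf.ennreal_ofReal
  have hF0 : ∀ x, ENNReal.ofReal (f x) ≠ 0 := fun x => by simpa using hfpos x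
  unfold renyiDiv
  split_ifs with hc
  · obtain ⟨hQP, hint⟩ := hc
    have hg : Measurable (Q.rnDeriv P) := Measure.measurable_rnDeriv Q P
    have hA0 := hne Q _ hF hF0
    have h1 : ((Real.log (∫ p, f p ∂Q) : ℝ) : EReal) ≤
        ENNReal.log (∫⁻ x, ENNReal.ofReal (f x) ∂Q) := by
      by_cases hA : ∫⁻ x, ENNReal.ofReal (f x) ∂Q = ⊤
      · rw [hA]; simp
      · rw [ENNReal.log_pos_real hA0 hA, integral_eq_lintegral_of_nonneg_ae
          (Eventually.of_forall fun x => (hfpos x).le) hf.aestronglyMeasurable]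
    refine h1.trans ?_
    have h2 := renyi_holder Q P hQP _ hF a lam ha hl
    have hGeq : ∫⁻ x, (Q.rnDeriv P x) ^ (a - 1) ∂Q
        = ENNReal.ofReal (∫ x, ((Q.rnDeriv P x).toReal) ^ (a - 1) ∂Q) := by
      rw [ofReal_integral_eq_lintegral_ofReal hint
        (Eventually.of_forall fun x => by positivity)]
      refine lintegral_congr_ae ?_
      filter_upwards [hQP.ae_le (Measure.rnDeriv_lt_top Q P)] with x hx
      rw [← ENNReal.ofReal_rpow_of_nonneg ENNReal.toReal_nonneg ha1.le,
        ENNReal.ofReal_toReal hx.ne]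
    have hG0 : 0 < ∫ x, ((Q.rnDeriv P x).toReal) ^ (a - 1) ∂Q := by
      rw [← ENNReal.ofReal_pos, ← hGeq, pos_iff_ne_zero]
      intro h0
      rw [lintegral_eq_zero_iff (hg.pow_const _)] at h0
      obtain ⟨x, hx, hx'⟩ := (h0.and (Measure.rnDeriv_pos hQP)).exists
      simp only [Pi.zero_apply, ENNReal.rpow_eq_zero_iff] at hx
      rcases hx with hx | hx
      · exact hx'.ne' hx.1
      · linarith [hx.2]
    refine (ENNReal.log_le_log h2).trans (le_of_eq ?_)
    rw [ENNReal.log_mul_add, ENNReal.log_rpow, ENNReal.log_rpow, ENNReal.log_rpow, hGeq,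
      ENNReal.log_ofReal_of_pos hG0, EReal.coe_mul (a - 1)⁻¹]
  · rw [EReal.coe_mul_top_of_pos (inv_pos.2 hl0), EReal.top_add_of_ne_bot]
    · exact le_top
    · rw [← ENNReal.log_rpow, Ne, ENNReal.log_eq_bot_iff, ENNReal.rpow_eq_zero_iff]
      have h0 := hne P (fun x => ENNReal.ofReal (f x) ^ lam) (hF.pow_const _) (fun x => by
        simp [ENNReal.rpow_eq_zero_iff, hl0.not_gt, hfpos x])
      rintro (h | h)
      · exact h0 h.1
      · exact absurd h.2 (inv_pos.2 hl0).not_gt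

/-- Theorem 5, part ii — in-expectation bound, Rényi version.
`log E_{P_{S,W}}[f] ≤ inf_{q, λ ≥ α/(α−1)} { (1/λ) D_α(P_{S,W} ‖ P_S ⊗ q)
  + (1/λ) log E_{P_S ⊗ q}[f^λ] }`. -/
theorem in_expectation_bound_Renyi
    {𝒵 𝒲 : Type*} [MeasurableSpace 𝒵] [MeasurableSpace 𝒲]
    (μ : Measure 𝒵) [IsProbabilityMeasure μ] {n : ℕ}
    (PWS : Kernel (Fin n → 𝒵) 𝒲) [IsMarkovKernel PWS]
    (f : (Fin n → 𝒵) × 𝒲 → ℝ) (hf : Measurable f) (hfpos : ∀ p, 0 < f p)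
    (α : ℝ) (hα : 1 < α) :
    ((Real.log (∫ p, f p ∂((Measure.pi fun _ : Fin n => μ) ⊗ₘ PWS)) : ℝ) : EReal) ≤
      ⨅ (q : Kernel (Fin n → 𝒵) 𝒲) (_ : IsMarkovKernel q)
        (lam : ℝ) (_ : α / (α - 1) ≤ lam),
        ((lam⁻¹ : ℝ) : EReal) *
            renyiDiv α ((Measure.pi fun _ : Fin n => μ) ⊗ₘ PWS)
              ((Measure.pi fun _ : Fin n => μ) ⊗ₘ q)
          + ((lam⁻¹ : ℝ) : EReal) *
            ENNReal.log (∫⁻ r, ENNReal.ofReal (f r ^ lam)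
              ∂((Measure.pi fun _ : Fin n => μ) ⊗ₘ q)) := by
  refine le_iInf fun q => le_iInf fun _ => le_iInf fun lam => le_iInf fun hl => ?_
  exact renyi_bound _ _ f hf hfpos α lam hα hl
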